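/- Let φ₁(x) = φ(x,β₁) and φ₂(x) = φ(x,β₂) be two GCHS densities with 0 ≤ β₁, β₂ < 14.4, and let ψ(x₁,x₂) = (1 + γ·r(x₁,β₁)·r(x₂,β₂))·φ₁(x₁)·φ₂(x₂) with γ chosen so that ψ ≥ 0. Then ψ is a joint probability density with marginals φ₁ and φ₂ (i.e., ∫ψ(x₁,x₂)dx₂ = φ₁(x₁) and ∫ψ(x₁,x₂)dx₁ = φ₂(x₂)), and the between-squares moment satisfies ∫∫ x₁²x₂²·ψ(x₁,x₂) dx₁dx₂ = 1 + γ. -/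

import Mathlib

open MeasureTheory Real

noncomputable def hsDensity (x : ℝ) : ℝ := (1 / 2) * (Real.cosh (Real.pi * x / 2))⁻¹

def p4 (x : ℝ) : ℝ := x ^ 4 - 14 * x ^ 2 + 9

noncomputable def gchs (x β : ℝ) : ℝ := (1 + (β / 576) * p4 x) * hsDensity x

noncomputable def rFun (x β : ℝ) : ℝ := (x ^ 2 - 1) / (4 + (β / 144) * p4 x)

noncomputable def copulaJoint (β₁ β₂ γ : ℝ) (x₁ x₂ : ℝ) : ℝ :=
  (1 + γ * rFun x₁ β₁ * rFun x₂ β₂) * gchs x₁ β₁ * gchs x₂ β₂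


lemma bern6 : bernoulli' 6 = 1 / 42 := by
  have h5 : bernoulli' 5 = 0 := bernoulli'_eq_zero_of_odd (by decide) (by norm_num)
  rw [bernoulli'_def]
  norm_num [Finset.sum_range_succ, h5, Nat.choose]

lemma hs_bern (n : ℕ) : (Polynomial.map (algebraMap ℚ ℝ) (Polynomial.bernoulli n)).eval (1/4 : ℝ)
    = ∑ i ∈ Finset.range (n + 1), ((bernoulli (n - i) * (n.choose i) * (1/4)^i : ℚ) : ℝ) := by
  rw [Polynomial.bernoulli_def, Polynomial.map_sum, Polynomial.eval_finsetSum]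
  apply Finset.sum_congr rfl
  intro i hi
  simp

lemma bern_vals : bernoulli 0 = 1 ∧ bernoulli 1 = -1/2 ∧ bernoulli 2 = 1/6 ∧ bernoulli 3 = 0 ∧
    bernoulli 4 = -1/30 ∧ bernoulli 5 = 0 ∧ bernoulli 6 = 1/42 ∧ bernoulli 7 = 0 := by
  refine ⟨by simp, by simp, ?_, ?_, ?_, ?_, ?_, ?_⟩
  · rw [bernoulli_eq_bernoulli'_of_ne_one (by norm_num), bernoulli'_two]
  · exact bernoulli_eq_zero_of_odd (by decide) (by norm_num)
  · rw [bernoulli_eq_bernoulli'_of_ne_one (by norm_num), bernoulli'_four]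
  · exact bernoulli_eq_zero_of_odd (by decide) (by norm_num)
  · rw [bernoulli_eq_bernoulli'_of_ne_one (by norm_num), bern6]
  · exact bernoulli_eq_zero_of_odd (by decide) (by norm_num)

lemma bern_eval3 : (Polynomial.map (algebraMap ℚ ℝ) (Polynomial.bernoulli 3)).eval (1/4 : ℝ)
    = 3 / 64 := by
  obtain ⟨h0, h1, h2, h3, h4, h5, h6, h7⟩ := bern_vals
  rw [hs_bern]
  norm_num [Finset.sum_range_succ, h0, h1, h2, h3, Nat.choose]

lemma bern_eval5 : (Polynomial.map (algebraMap ℚ ℝ) (Polynomial.bernoulli 5)).eval (1/4 : ℝ)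
    = -25 / 1024 := by
  obtain ⟨h0, h1, h2, h3, h4, h5, h6, h7⟩ := bern_vals
  rw [hs_bern]
  norm_num [Finset.sum_range_succ, h0, h1, h2, h3, h4, h5, Nat.choose]

lemma bern_eval7 : (Polynomial.map (algebraMap ℚ ℝ) (Polynomial.bernoulli 7)).eval (1/4 : ℝ)
    = 427 / 16384 := by
  obtain ⟨h0, h1, h2, h3, h4, h5, h6, h7⟩ := bern_vals
  rw [hs_bern]
  norm_num [Finset.sum_range_succ, h0, h1, h2, h3, h4, h5, h6, h7, Nat.choose]

lemma hs_hasSum {t : ℝ} (ht : 0 < t) :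
    HasSum (fun n : ℕ => Real.sin (2 * π * n * (1/4)) * rexp (-(π * n / 2) * t)) (hsDensity t) := by
  set q : ℝ := rexp (-(π * t / 2)) with hq
  have hq0 : 0 < q := exp_pos _
  have hq1 : q < 1 := by
    rw [hq, Real.exp_lt_one_iff]
    have := mul_pos pi_pos ht
    linarith
  have h := hasSum_geometric_of_norm_lt_one (ξ := (Complex.I * q : ℂ))
    (by simp [abs_of_pos hq0, hq1])
  have h2 := Complex.hasSum_im h
  convert h2 using 1
  · ext n
    have : (Complex.I * q : ℂ) = Complex.exp (((-(π * t / 2) : ℝ) : ℂ) + ((π / 2 : ℝ) : ℂ) * Complex.I) := by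
      rw [Complex.exp_add]
      push_cast
      rw [Complex.exp_pi_div_two_mul_I, hq]
      push_cast
      ring
    rw [this, ← Complex.exp_nat_mul, Complex.exp_im]
    have e1 : ((n : ℂ) * (((-(π * t / 2) : ℝ) : ℂ) + ((π / 2 : ℝ) : ℂ) * Complex.I)).re = -(π * n / 2) * t := by
      simp; ring
    have e2 : ((n : ℂ) * (((-(π * t / 2) : ℝ) : ℂ) + ((π / 2 : ℝ) : ℂ) * Complex.I)).im = 2 * π * n * (1/4) := by
      simp; ring
    rw [e1, e2]
    ring
  · have hc : Real.cosh (π * t / 2) = (q⁻¹ + q) / 2 := by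
      rw [Real.cosh_eq, hq, ← Real.exp_neg, neg_neg]
    simp only [hsDensity, hc, Complex.inv_im, Complex.normSq_apply]
    simp
    field_simp

lemma hs_half_moment {k : ℕ} (hk : k ≠ 0) :
    ∫ t in Set.Ioi (0:ℝ), t ^ (2 * k) * hsDensity t =
      (2 * k).factorial * (2 / π) ^ (2 * k + 1) *
      ((-1 : ℝ) ^ (k + 1) * (2 * π) ^ (2 * k + 1) / 2 / (2 * k + 1).factorial *
        (Polynomial.map (algebraMap ℚ ℝ) (Polynomial.bernoulli (2 * k + 1))).eval (1/4)) := by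
  have hs := hasSum_one_div_nat_pow_mul_sin hk (x := 1/4) (by norm_num)
  have hm := hasSum_mellin (a := fun n : ℕ => ((Real.sin (2 * π * n * (1/4)) : ℝ) : ℂ))
    (p := fun n : ℕ => π * n / 2) (F := fun t => ((hsDensity t : ℝ) : ℂ)) (s := ((2 * k : ℕ) : ℂ) + 1)
    ?_ ?_ ?_ ?_
  · have e : mellin (fun t => ((hsDensity t : ℝ) : ℂ)) (((2 * k : ℕ) : ℂ) + 1)
        = ((∫ t in Set.Ioi (0:ℝ), t ^ (2 * k) * hsDensity t : ℝ) : ℂ) := by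
      rw [mellin, ← integral_complex_ofReal]
      simp only [add_sub_cancel_right, Complex.cpow_natCast, smul_eq_mul]
      push_cast
      rfl
    rw [e] at hm
    have hs2 := hs.mul_left ((2 * k).factorial * (2 / π) ^ (2 * k + 1))
    refine HasSum.unique (Complex.hasSum_ofReal.mp ?_) hs2
    convert hm using 1
    ext n
    rw [Complex.Gamma_nat_eq_factorial,
      show (((2 * k : ℕ) : ℂ) + 1) = ((2 * k + 1 : ℕ) : ℂ) by push_cast; ring, Complex.cpow_natCast]
    norm_cast
    rw [div_pow, div_pow, mul_pow]
    have := pi_pos.ne'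
    rcases eq_or_ne n 0 with rfl | hn
    · simp
    · field_simp
      push_cast
      ring
  · intro n
    rcases eq_or_ne n 0 with rfl | hn
    · left; simp
    · right
      have : (0:ℝ) < n := by positivity
      positivity
  · simp; positivity
  · intro t ht
    have := Complex.hasSum_ofReal.mpr (hs_hasSum ht)
    convert this using 1
    ext n
    push_cast
    rfl
  · have h1 : Summable (fun n : ℕ => (2 / π) ^ (2 * k + 1) * (1 / (n : ℝ) ^ (2 * k + 1))) :=
      (Real.summable_one_div_nat_pow.mpr (by omega)).mul_left _
    refine Summable.of_nonneg_of_le (fun n => by positivity) (fun n => ?_) h1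
    rw [show ((((2 * k : ℕ) : ℂ) + 1)).re = ((2 * k + 1 : ℕ) : ℝ) by simp, Real.rpow_natCast]
    have hb : ‖((Real.sin (2 * π * n * (1/4)) : ℝ) : ℂ)‖ ≤ 1 := by
      rw [Complex.norm_real]; exact Real.abs_sin_le_one _
    calc _ ≤ 1 / (π * n / 2) ^ (2 * k + 1) := by gcongr
      _ = _ := by
        rw [div_pow, div_pow, mul_pow]
        rcases eq_or_ne n 0 with rfl | hn
        · simp
        · have := pi_pos.ne'
          field_simp

lemma hs_even (x : ℝ) : hsDensity |x| = hsDensity x := by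
  rcases abs_choice x with h | h <;> rw [h]
  unfold hsDensity
  rw [show π * -x / 2 = -(π * x / 2) by ring, Real.cosh_neg]

lemma hs_cont : Continuous hsDensity := by
  unfold hsDensity
  have : ∀ x : ℝ, Real.cosh (π * x / 2) ≠ 0 := fun x => (Real.cosh_pos _).ne'
  have h2 : Continuous fun x : ℝ => Real.cosh (π * x / 2) := Real.continuous_cosh.comp (by fun_prop)
  exact continuous_const.mul (h2.inv₀ this)

lemma hs_nonneg (x : ℝ) : 0 ≤ hsDensity x := by
  unfold hsDensity
  have := Real.cosh_pos (π * x / 2)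
  positivity

lemma hs_int_Ioi (k : ℕ) : IntegrableOn (fun x : ℝ => x ^ (2 * k) * hsDensity x) (Set.Ioi 0) := by
  have h := integrableOn_rpow_mul_exp_neg_mul_rpow (p := 1) (s := ((2 * k : ℕ) : ℝ)) (b := π / 2)
    (by have : (0:ℝ) ≤ ((2 * k : ℕ) : ℝ) := by positivity
        linarith) one_pos (by positivity)
  refine Integrable.mono' h ((by have := hs_cont; fun_prop : Continuous _).aestronglyMeasurable) ?_
  filter_upwards [ae_restrict_mem measurableSet_Ioi] with x hx
  have hx : (0:ℝ) < x := hx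
  rw [Real.norm_of_nonneg (mul_nonneg (by positivity) (hs_nonneg x)), Real.rpow_natCast, Real.rpow_one]
  gcongr
  unfold hsDensity
  rw [Real.cosh_eq, show -(π / 2) * x = -(π * x / 2) by ring, Real.exp_neg]
  have := Real.exp_pos (π * x / 2)
  rw [← one_div, ← one_div, div_mul_div_comm, div_le_div_iff₀ (by positivity) (by positivity)]
  have : 0 < (rexp (π * x / 2))⁻¹ := by positivity
  rw [one_div]
  linarith

lemma hs_int (k : ℕ) : Integrable (fun x : ℝ => x ^ (2 * k) * hsDensity x) := by
  rw [← integrableOn_univ, ← Set.Iio_union_Ici (a := (0:ℝ)), integrableOn_union,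
    integrableOn_Ici_iff_integrableOn_Ioi]
  refine ⟨?_, hs_int_Ioi k⟩
  have := (hs_int_Ioi k)
  rw [← neg_zero] at this
  have := this.comp_neg_Iio
  refine this.congr_fun (fun x _ => ?_) measurableSet_Iio
  simp only
  rw [← hs_even (-x), abs_neg, hs_even, Even.neg_pow (by simp)]

lemma hs_moment {k : ℕ} (hk : k ≠ 0) :
    ∫ t : ℝ, t ^ (2 * k) * hsDensity t = (-1) ^ (k + 1) * 4 ^ (2 * k + 1) / (2 * k + 1) *
        (Polynomial.map (algebraMap ℚ ℝ) (Polynomial.bernoulli (2 * k + 1))).eval (1/4) := by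
  have h : ∀ t : ℝ, t ^ (2 * k) * hsDensity t = (fun u : ℝ => u ^ (2 * k) * hsDensity u) |t| := by
    intro t
    simp only
    rw [hs_even, Even.pow_abs (by simp)]
  rw [integral_congr_ae (Filter.Eventually.of_forall h), integral_comp_abs (f := fun u : ℝ => u ^ (2 * k) * hsDensity u), hs_half_moment hk,
    Nat.factorial_succ]
  have h4 : (4:ℝ) ^ (2 * k + 1) = (2 / π) ^ (2 * k + 1) * (2 * π) ^ (2 * k + 1) := by
    rw [← mul_pow]; congr 1
    have := pi_pos.ne'
    field_simp; norm_num
  rw [h4]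
  have := Nat.factorial_ne_zero (2 * k)
  push_cast
  field_simp

lemma hs_m0 : ∫ t : ℝ, hsDensity t = 1 := by
  have hi : Integrable hsDensity := by simpa using hs_int 0
  have hp := pi_pos
  have hlin : ∀ x : ℝ, HasDerivAt (fun x : ℝ => π * x / 2) (π / 2) x := fun x => by
    simpa using ((hasDerivAt_id x).const_mul π).div_const 2
  have hd : ∀ x, HasDerivAt (fun x => (1 / π) * Real.arctan (Real.sinh (π * x / 2))) (hsDensity x) x := by
    intro x
    have := (((hlin x).sinh).arctan).const_mul (1 / π)
    refine this.congr_deriv ?_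
    unfold hsDensity
    have hc := Real.cosh_pos (π * x / 2)
    rw [show 1 + Real.sinh (π * x / 2) ^ 2 = Real.cosh (π * x / 2) ^ 2 by rw [Real.cosh_sq]; ring]
    field_simp
  have htop : Filter.Tendsto (fun x : ℝ => π * x / 2) Filter.atTop Filter.atTop :=
    (Filter.tendsto_id.const_mul_atTop hp).atTop_div_const two_pos
  have hbot : Filter.Tendsto (fun x : ℝ => π * x / 2) Filter.atBot Filter.atBot :=
    (Filter.tendsto_id.const_mul_atBot hp).atBot_div_const two_pos
  have h1 := ((tendsto_nhds_of_tendsto_nhdsWithin tendsto_arctan_atTop).comp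
    (Real.sinhOrderIso.tendsto_atTop.comp htop)).const_mul (1 / π)
  have h2 := ((tendsto_nhds_of_tendsto_nhdsWithin tendsto_arctan_atBot).comp
    (Real.sinhOrderIso.tendsto_atBot.comp hbot)).const_mul (1 / π)
  rw [integral_of_hasDerivAt_of_tendsto hd hi h2 h1]
  field_simp
  norm_num

lemma hs_m2 : ∫ t : ℝ, t ^ 2 * hsDensity t = 1 := by
  have := hs_moment (k := 1) (by norm_num)
  norm_num [bern_eval3] at this
  rw [this]
  have := bern_eval3
  norm_num at this
  norm_num [this]

lemma hs_m4 : ∫ t : ℝ, t ^ 4 * hsDensity t = 5 := by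
  have := hs_moment (k := 2) (by norm_num)
  norm_num at this
  rw [this]
  have := bern_eval5
  norm_num at this
  norm_num [this]

lemma hs_m6 : ∫ t : ℝ, t ^ 6 * hsDensity t = 61 := by
  have := hs_moment (k := 3) (by norm_num)
  norm_num at this
  rw [this]
  have := bern_eval7
  norm_num at this
  norm_num [this]

/-- integral of an even polynomial of degree at most six against the density -/
lemma hs_poly (a b c d : ℝ) :
    ∫ t : ℝ, (a + b * t ^ 2 + c * t ^ 4 + d * t ^ 6) * hsDensity t = a + b + 5 * c + 61 * d := by
  have i0 : Integrable (fun t : ℝ => a * hsDensity t) :=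
    (by simpa using hs_int 0 : Integrable hsDensity).const_mul a
  have i2 : Integrable (fun t : ℝ => b * (t ^ 2 * hsDensity t)) := (hs_int 1).const_mul b
  have i4 : Integrable (fun t : ℝ => c * (t ^ 4 * hsDensity t)) := (hs_int 2).const_mul c
  have i6 : Integrable (fun t : ℝ => d * (t ^ 6 * hsDensity t)) := (hs_int 3).const_mul d
  have e : ∀ t : ℝ, (a + b * t ^ 2 + c * t ^ 4 + d * t ^ 6) * hsDensity t =
      a * hsDensity t + b * (t ^ 2 * hsDensity t) + c * (t ^ 4 * hsDensity t)
        + d * (t ^ 6 * hsDensity t) := fun t => by ring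
  simp_rw [e]
  have i02 : Integrable (fun t : ℝ => a * hsDensity t + b * (t ^ 2 * hsDensity t)) := i0.add i2
  have i024 : Integrable (fun t : ℝ => a * hsDensity t + b * (t ^ 2 * hsDensity t)
    + c * (t ^ 4 * hsDensity t)) := i02.add i4
  rw [integral_add i024 i6, integral_add i02 i4, integral_add i0 i2]
  simp only [integral_const_mul, hs_m0, hs_m2, hs_m4, hs_m6]
  ring

lemma r_mul_gchs {β : ℝ} (h0 : 0 ≤ β) (h : β < 14.4) (x : ℝ) :
    rFun x β * gchs x β = (x ^ 2 - 1) / 4 * hsDensity x := by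
  have hp : -40 ≤ p4 x := by
    unfold p4
    nlinarith [sq_nonneg (x ^ 2 - 7)]
  have hd : 0 < 4 + (β / 144) * p4 x := by
    norm_num at h
    nlinarith
  unfold rFun gchs
  rw [show 1 + β / 576 * p4 x = (4 + (β / 144) * p4 x) / 4 by ring]
  generalize 4 + (β / 144) * p4 x = D at hd
  field_simp

lemma joint_eq {β₁ β₂ : ℝ} (γ : ℝ) (h₁0 : 0 ≤ β₁) (h₁ : β₁ < 14.4) (h₂0 : 0 ≤ β₂) (h₂ : β₂ < 14.4)
    (x y : ℝ) : copulaJoint β₁ β₂ γ x y = gchs x β₁ * gchs y β₂ +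
      γ * ((x ^ 2 - 1) / 4 * hsDensity x) * ((y ^ 2 - 1) / 4 * hsDensity y) := by
  rw [← r_mul_gchs h₁0 h₁, ← r_mul_gchs h₂0 h₂]
  unfold copulaJoint
  ring

/-- the marginal integral: with arbitrary coefficients -/
lemma marg (β A B : ℝ) :
    ∫ y : ℝ, (A * gchs y β + B * ((y ^ 2 - 1) / 4 * hsDensity y)) = A := by
  have e : ∀ y : ℝ, A * gchs y β + B * ((y ^ 2 - 1) / 4 * hsDensity y) =
    ((A * (1 + β / 576 * 9) - B / 4) + (A * (β / 576 * (-14)) + B / 4) * y ^ 2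
      + (A * (β / 576)) * y ^ 4 + 0 * y ^ 6) * hsDensity y := fun y => by
    unfold gchs p4; ring
  simp_rw [e]
  rw [hs_poly]
  ring

lemma marg_sq (β A B : ℝ) :
    ∫ y : ℝ, y ^ 2 * (A * gchs y β + B * ((y ^ 2 - 1) / 4 * hsDensity y)) = A + B := by
  have e : ∀ y : ℝ, y ^ 2 * (A * gchs y β + B * ((y ^ 2 - 1) / 4 * hsDensity y)) =
    (0 + (A * (1 + β / 576 * 9) - B / 4) * y ^ 2 + (A * (β / 576 * (-14)) + B / 4) * y ^ 4
      + (A * (β / 576)) * y ^ 6) * hsDensity y := fun y => by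
    unfold gchs p4; ring
  simp_rw [e]
  rw [hs_poly]
  ring

theorem copulaJoint_properties {β₁ β₂ γ : ℝ}
    (h₁0 : 0 ≤ β₁) (h₁ : β₁ < 14.4) (h₂0 : 0 ≤ β₂) (h₂ : β₂ < 14.4)
    (hpos : ∀ x₁ x₂ : ℝ, 0 ≤ copulaJoint β₁ β₂ γ x₁ x₂) :
    (∀ x₁ : ℝ, ∫ x₂ : ℝ, copulaJoint β₁ β₂ γ x₁ x₂ = gchs x₁ β₁) ∧
    (∀ x₂ : ℝ, ∫ x₁ : ℝ, copulaJoint β₁ β₂ γ x₁ x₂ = gchs x₂ β₂) ∧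
    (∫ x₁ : ℝ, ∫ x₂ : ℝ, x₁ ^ 2 * x₂ ^ 2 * copulaJoint β₁ β₂ γ x₁ x₂ = 1 + γ) := by
  have hj := joint_eq γ h₁0 h₁ h₂0 h₂
  refine ⟨fun x => ?_, fun y => ?_, ?_⟩
  · simp_rw [hj]
    exact marg β₂ _ _
  · rw [← marg β₁ (gchs y β₂) (γ * ((y ^ 2 - 1) / 4 * hsDensity y))]
    congr 1
    ext x
    rw [hj]
    ring
  · have e : ∀ x : ℝ, ∫ y : ℝ, x ^ 2 * y ^ 2 * copulaJoint β₁ β₂ γ x y =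
        x ^ 2 * (1 * gchs x β₁ + γ * ((x ^ 2 - 1) / 4 * hsDensity x)) := by
      intro x
      simp_rw [hj, mul_assoc (x ^ 2)]
      rw [integral_const_mul, one_mul]
      congr 1
      exact marg_sq β₂ _ _
    simp_rw [e]
    exact marg_sq β₁ 1 γ
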